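/- Let R be a commutative ring, let φ : R^m → R^n be an R-linear map, and let d ≥ 1. Then the integral closure of the ideal I(S^d(φ)) equals the integral closure of the ideal I(φ)^s, where s = binomial(n+d-1, d-1). -/

import Mathlib

noncomputable section

/-- `I_t(A)`: the ideal of `R` generated by the `t × t` minors of the matrix `A`. -/
def minorsIdeal {R : Type*} [CommRing R] (t : ℕ) {N M : Type*} (A : Matrix N M R) : Ideal R :=
  Ideal.span {x : R | ∃ (r : Fin t → N) (c : Fin t → M), x = (A.submatrix r c).det}

/-- The matrix (in the standard bases of monomials) of the `d`-th symmetric power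
`S^d(φ) : S^d(R^m) → S^d(R^n)` of the linear map `φ : R^m → R^n` given by the
`n × m` matrix `A`: the `(μ, ν)` entry is the coefficient of the monomial `x^μ` in
`Π_{j ∈ ν} φ(x_j)`, computed in the symmetric algebra `R[x_1, …, x_n]` of `R^n`. -/
def symPowMatrix {R : Type*} [CommRing R] {m n : ℕ} (d : ℕ) (A : Matrix (Fin n) (Fin m) R) :
    Matrix (Sym (Fin n) d) (Sym (Fin m) d) R := fun μ ν =>
  MvPolynomial.coeff (Multiset.toFinsupp (μ : Multiset (Fin n)))
    (((ν : Multiset (Fin m)).map fun j =>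
        ∑ i : Fin n, MvPolynomial.C (A i j) * MvPolynomial.X i).prod)

/-- The integral closure of an ideal `I ⊆ R`: the set of `x ∈ R` satisfying an equation
`x^k + a_1 x^{k-1} + ⋯ + a_k = 0` with `a_i ∈ I^i` for all `i`. -/
def Ideal.intClosure {R : Type*} [CommRing R] (I : Ideal R) : Set R :=
  {x : R | ∃ k : ℕ, 0 < k ∧ ∃ a : ℕ → R, (∀ i ∈ Finset.Icc 1 k, a i ∈ I ^ i) ∧
      x ^ k + ∑ i ∈ Finset.Icc 1 k, a i * x ^ (k - i) = 0}


open MvPolynomial in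
lemma MvPolynomial.IsHomogeneous.eq_sum_sym {R : Type*} [CommRing R] {m d : ℕ}
    {p : MvPolynomial (Fin m) R} (hp : p.IsHomogeneous d) :
    p = ∑ κ : Sym (Fin m) d, C (coeff (Multiset.toFinsupp (κ : Multiset (Fin m))) p) *
      ((κ : Multiset (Fin m)).map X).prod := by
  have key (κ : Multiset (Fin m)) :
      (κ.map X).prod = (monomial (Multiset.toFinsupp κ) (1 : R)) := by
    induction κ using Multiset.induction_on with
    | empty => simp
    | cons a s ih =>
      rw [Multiset.map_cons, Multiset.prod_cons, ih, X, monomial_mul, one_mul,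
        ← Multiset.singleton_add, map_add, Multiset.toFinsupp_singleton]
  ext e
  simp only [key, coeff_sum, coeff_C_mul, coeff_monomial]
  by_cases he : e.degree = d
  · have hc : Multiset.card (Finsupp.toMultiset e) = d := by
      rw [Finsupp.card_toMultiset, ← he]; rfl
    rw [Finset.sum_eq_single (Sym.mk (Finsupp.toMultiset e) hc)]
    · simp [Sym.mk]
    · intro b _ hb
      rw [if_neg, mul_zero]
      rintro rfl
      exact hb (Subtype.ext (by simp))
    · simp
  · rw [hp.coeff_eq_zero he, Finset.sum_eq_zero]
    intro b _
    rw [if_neg, mul_zero]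
    rintro rfl
    apply he
    have hb : Multiset.card (b : Multiset (Fin m)) = d := b.2
    exact (Multiset.toFinsupp_sum_eq (b : Multiset (Fin m))).trans hb

open MvPolynomial in
lemma isHomogeneous_prod_columns {R : Type*} [CommRing R] {m n : ℕ}
    (A : Matrix (Fin n) (Fin m) R) (s : Multiset (Fin m)) :
    ((s.map fun j => ∑ i : Fin n, C (A i j) * X i).prod).IsHomogeneous (Multiset.card s) := by
  induction s using Multiset.induction_on with
  | empty => simpa using isHomogeneous_one _ _
  | cons a s ih =>
    rw [Multiset.map_cons, Multiset.prod_cons, Multiset.card_cons, add_comm]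
    refine IsHomogeneous.mul (IsHomogeneous.sum _ _ _ fun i _ => ?_) ih
    exact isHomogeneous_C_mul_X _ _

open MvPolynomial in
lemma symPowMatrix_mul {R : Type*} [CommRing R] {m n p : ℕ} (d : ℕ)
    (A : Matrix (Fin n) (Fin m) R) (B : Matrix (Fin m) (Fin p) R) :
    symPowMatrix d (A * B) = symPowMatrix d A * symPowMatrix d B := by
  ext μ ν
  let F : MvPolynomial (Fin m) R →ₐ[R] MvPolynomial (Fin n) R :=
    aeval fun k => ∑ i : Fin n, C (A i k) * X i
  have hF : ((ν : Multiset (Fin p)).map fun j => ∑ i : Fin n, C ((A * B) i j) * X i).prod =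
      F (((ν : Multiset (Fin p)).map fun j => ∑ k : Fin m, C (B k j) * X k).prod) := by
    rw [map_multiset_prod, Multiset.map_map]
    congr 1
    refine Multiset.map_congr rfl fun j _ => ?_
    simp only [Function.comp_apply, map_sum, map_mul, F, aeval_X, algHom_C, Matrix.mul_apply,
      algebraMap_eq, Finset.mul_sum, Finset.sum_mul]
    rw [Finset.sum_comm]
    refine Finset.sum_congr rfl fun _ _ => Finset.sum_congr rfl fun _ _ => by ring
  have hh := (isHomogeneous_prod_columns B (ν : Multiset (Fin p))).eq_sum_sym
  rw [show Multiset.card (ν : Multiset (Fin p)) = d from ν.2] at hh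
  rw [symPowMatrix, hF, hh, map_sum, coeff_sum, Matrix.mul_apply]
  refine Finset.sum_congr rfl fun κ _ => ?_
  rw [map_mul, algHom_C, algebraMap_eq, coeff_C_mul, map_multiset_prod, Multiset.map_map, mul_comm]
  simp only [symPowMatrix, F, Function.comp_def, aeval_X]

lemma symPowMatrix_map {R S : Type*} [CommRing R] [CommRing S] (f : R →+* S) {m n : ℕ} (d : ℕ)
    (A : Matrix (Fin n) (Fin m) R) :
    symPowMatrix d (A.map f) = (symPowMatrix d A).map f := by
  ext μ ν
  simp [symPowMatrix, ← MvPolynomial.coeff_map, map_multiset_prod]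

lemma symPowMatrix_submatrix {R : Type*} [CommRing R] {m n p : ℕ} (d : ℕ)
    (A : Matrix (Fin n) (Fin m) R) (c : Fin p → Fin m) :
    symPowMatrix d (A.submatrix id c) = (symPowMatrix d A).submatrix id (Sym.map c) := by
  ext μ ν
  simp [symPowMatrix]

open MvPolynomial in
lemma symPowMatrix_diagonal {R : Type*} [CommRing R] {n : ℕ} (d : ℕ) (v : Fin n → R) :
    symPowMatrix d (Matrix.diagonal v) =
      Matrix.diagonal fun ν : Sym (Fin n) d => ((ν : Multiset (Fin n)).map v).prod := by
  have key (s : Multiset (Fin n)) :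
      (s.map fun j => ∑ i : Fin n, C (Matrix.diagonal v i j) * X i).prod =
        (monomial (Multiset.toFinsupp s) ((s.map v).prod) : MvPolynomial (Fin n) R) := by
    induction s using Multiset.induction_on with
    | empty => simp
    | cons a s ih =>
      rw [Multiset.map_cons, Multiset.prod_cons, ih, Finset.sum_eq_single a, C_mul_X_eq_monomial,
        monomial_mul, ← Multiset.singleton_add, map_add, Multiset.toFinsupp_singleton]
      · simp
      · intro b _ hb
        simp [Matrix.diagonal_apply_ne _ hb]
      · simp
  ext μ ν
  rw [symPowMatrix, key, coeff_monomial, Matrix.diagonal_apply]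
  by_cases h : μ = ν
  · simp [h]
  · rw [if_neg h, if_neg]
    exact fun h' => h (Subtype.ext (Multiset.toFinsupp.injective h'.symm))

lemma sum_count_sym {n d : ℕ} (hd : 1 ≤ d) (i : Fin n) :
    ∑ ν : Sym (Fin n) d, (ν : Multiset (Fin n)).count i = (n + d - 1).choose (d - 1) := by
  have hsymm (j : Fin n) : ∑ ν : Sym (Fin n) d, (ν : Multiset (Fin n)).count j =
      ∑ ν : Sym (Fin n) d, (ν : Multiset (Fin n)).count i := by
    refine Fintype.sum_equiv (Sym.equivCongr (Equiv.swap i j)) _ _ fun ν => ?_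
    have := Multiset.count_map_eq_count' (Equiv.swap i j) (ν : Multiset (Fin n))
      (Equiv.swap i j).injective j
    rw [Equiv.swap_apply_right] at this
    rw [← this]
    rfl
  have htot : ∑ j : Fin n, ∑ ν : Sym (Fin n) d, (ν : Multiset (Fin n)).count j =
      Fintype.card (Sym (Fin n) d) * d := by
    have hcard (ν : Sym (Fin n) d) : ∑ j : Fin n, (ν : Multiset (Fin n)).count j = d :=
      (Multiset.sum_count_eq_card (by simp)).trans ν.2
    rw [Finset.sum_comm, Finset.sum_congr rfl fun ν _ => hcard ν]
    simp
  rw [Finset.sum_congr rfl fun j _ => hsymm j] at htot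
  simp only [Finset.sum_const, Finset.card_univ, Fintype.card_fin, smul_eq_mul,
    Sym.card_sym_eq_choose] at htot
  have hn : 0 < n := i.pos
  apply Nat.eq_of_mul_eq_mul_left hn
  rw [htot]
  obtain ⟨e, rfl⟩ : ∃ e, d = e + 1 := ⟨d - 1, by omega⟩
  have := Nat.choose_succ_right_eq (n + e) e
  rw [Nat.add_sub_cancel] at this
  rw [Nat.add_sub_cancel, ← Nat.add_assoc, Nat.add_sub_cancel, this, mul_comm]

lemma det_symPowMatrix_diagonal {R : Type*} [CommRing R] {n d : ℕ} (hd : 1 ≤ d) (v : Fin n → R) :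
    (symPowMatrix d (Matrix.diagonal v)).det = (∏ i, v i) ^ ((n + d - 1).choose (d - 1)) := by
  rw [symPowMatrix_diagonal, Matrix.det_diagonal, ← Finset.prod_pow]
  have hpow (i : Fin n) : v i ^ ((n + d - 1).choose (d - 1)) =
      ∏ ν : Sym (Fin n) d, v i ^ (ν : Multiset (Fin n)).count i := by
    rw [← sum_count_sym hd i, Finset.prod_pow_eq_pow_sum]
  rw [Finset.prod_congr rfl fun i _ => hpow i, Finset.prod_comm]
  refine Finset.prod_congr rfl fun ν _ => ?_
  rw [Finset.prod_multiset_map_count]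
  refine Finset.prod_subset (Finset.subset_univ _) fun i _ hi => ?_
  rw [Multiset.count_eq_zero_of_notMem (by simpa using hi), pow_zero]

open Matrix in
lemma det_symPowMatrix_transvection {K : Type*} [Field K] {n d : ℕ} (hd : 1 ≤ d) {x : K}
    (hx : x ≠ 0) (hx1 : 1 + x ≠ 0) {i j : Fin n} (hij : i ≠ j) (c : K) :
    (symPowMatrix d (transvection i j c)).det = 1 := by
  have hmul (a b : K) : (symPowMatrix d (transvection i j (a + b))).det =
      (symPowMatrix d (transvection i j a)).det * (symPowMatrix d (transvection i j b)).det := by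
    rw [← transvection_mul_transvection_same _ _ hij, symPowMatrix_mul, det_mul]
  have hscale (y : K) (hy : y ≠ 0) (a : K) : (symPowMatrix d (transvection i j (y * a))).det =
      (symPowMatrix d (transvection i j a)).det := by
    set D : Matrix (Fin n) (Fin n) K := diagonal (Function.update 1 i y)
    have hD : transvection i j (y * a) * D = D * transvection i j a := by
      simp only [transvection, add_mul, mul_add, one_mul, mul_one]
      congr 1
      ext k l
      simp only [D, mul_diagonal, diagonal_mul, single_apply]
      split_ifs with h
      · rw [← h.1, ← h.2]
        simp [Function.update_of_ne hij.symm]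
      · simp
    have h0 : (symPowMatrix d D).det ≠ 0 := by
      rw [det_symPowMatrix_diagonal hd]
      refine pow_ne_zero _ (Finset.prod_ne_zero_iff.2 fun k _ => ?_)
      by_cases hk : k = i
      · simp [hk, hy]
      · simp [hk]
    have := congrArg (fun M => (symPowMatrix d M).det) hD
    simp only [symPowMatrix_mul, det_mul] at this
    rw [mul_comm] at this
    exact mul_left_cancel₀ h0 this
  have h1 : (symPowMatrix d (transvection i j (0 : K))).det = 1 := by
    rw [transvection_zero, ← diagonal_one, det_symPowMatrix_diagonal hd]
    simp
  have hne : (symPowMatrix d (transvection i j c)).det ≠ 0 := by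
    intro h
    have := hmul c (-c)
    rw [add_neg_cancel, h1, h, zero_mul] at this
    exact one_ne_zero this
  have h := hscale (1 + x) hx1 c
  rw [add_mul, one_mul, hmul, hscale x hx] at h
  exact mul_left_cancel₀ hne (by rw [h, mul_one])

open Matrix in
lemma det_symPowMatrix_field {K : Type*} [Field K] {n d : ℕ} (hd : 1 ≤ d) {x : K}
    (hx : x ≠ 0) (hx1 : 1 + x ≠ 0) (A : Matrix (Fin n) (Fin n) K) :
    (symPowMatrix d A).det = A.det ^ ((n + d - 1).choose (d - 1)) := by
  refine diagonal_transvection_induction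
    (fun A => (symPowMatrix d A).det = A.det ^ ((n + d - 1).choose (d - 1))) A ?_ ?_ ?_
  · intro D _
    rw [det_symPowMatrix_diagonal hd, det_diagonal]
  · intro t
    rw [t.det, one_pow]
    exact det_symPowMatrix_transvection hd hx hx1 t.hij t.c
  · intro A B hA hB
    rw [symPowMatrix_mul, det_mul, det_mul, hA, hB, mul_pow]

lemma det_symPowMatrix {R : Type*} [CommRing R] [IsDomain R] {n d : ℕ} (hd : 1 ≤ d)
    (A : Matrix (Fin n) (Fin n) R) :
    (symPowMatrix d A).det = A.det ^ ((n + d - 1).choose (d - 1)) := by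
  let f : R →+* FractionRing (Polynomial R) :=
    (algebraMap (Polynomial R) (FractionRing (Polynomial R))).comp Polynomial.C
  have hi := IsFractionRing.injective (Polynomial R) (FractionRing (Polynomial R))
  have hf : Function.Injective f := hi.comp Polynomial.C_injective
  have hx : algebraMap (Polynomial R) (FractionRing (Polynomial R)) Polynomial.X ≠ 0 :=
    (map_ne_zero_iff _ hi).2 Polynomial.X_ne_zero
  have hx1 : 1 + algebraMap (Polynomial R) (FractionRing (Polynomial R)) Polynomial.X ≠ 0 := by
    rw [← map_one (algebraMap (Polynomial R) (FractionRing (Polynomial R))), ← map_add, add_comm,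
      ← Polynomial.C_1]
    exact (map_ne_zero_iff _ hi).2 (Polynomial.X_add_C_ne_zero 1)
  have := det_symPowMatrix_field hd hx hx1 (A.map f)
  rw [symPowMatrix_map] at this
  apply hf
  rw [RingHom.map_det, map_pow, RingHom.map_det]
  exact this

lemma minorsIdeal_map {R S : Type*} [CommRing R] [CommRing S] (f : R →+* S) (t : ℕ)
    {N M : Type*} (A : Matrix N M R) :
    (minorsIdeal t A).map f = minorsIdeal t (A.map f) := by
  rw [minorsIdeal, minorsIdeal, Ideal.map_span]
  congr 1
  ext y
  constructor
  · rintro ⟨_, ⟨r, c, rfl⟩, rfl⟩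
    exact ⟨r, c, by rw [RingHom.map_det]; rfl⟩
  · rintro ⟨r, c, rfl⟩
    exact ⟨_, ⟨r, c, rfl⟩, by rw [RingHom.map_det]; rfl⟩

lemma det_submatrix_mul {R : Type*} [CommRing R] {t : ℕ} {N M : Type*} [Fintype N] [DecidableEq N]
    (e : Fin t ≃ N) (B : Matrix N N R) (C : Matrix N M R) (r : Fin t → N) (c : Fin t → M) :
    ((B * C).submatrix r c).det =
      ((1 : Matrix N N R).submatrix r e).det * B.det * (C.submatrix e c).det := by
  rw [← Matrix.det_submatrix_equiv_self e B, ← Matrix.det_mul, ← Matrix.det_mul,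
    Matrix.submatrix_mul_equiv, Matrix.one_mul, Matrix.submatrix_mul_equiv]

lemma minorsIdeal_mul_le {R : Type*} [CommRing R] {t : ℕ} {N M : Type*} [Fintype N]
    [DecidableEq N] (ht : Fintype.card N = t) (B : Matrix N N R) (C : Matrix N M R) :
    minorsIdeal t (B * C) ≤ Ideal.span {B.det} := by
  rw [minorsIdeal, Ideal.span_le]
  rintro _ ⟨r, c, rfl⟩
  rw [det_submatrix_mul (Fintype.equivFinOfCardEq ht).symm, mul_comm, ← mul_assoc]
  exact Ideal.mul_mem_left _ _ (Ideal.mem_span_singleton_self _)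

lemma det_submatrix_mem_minorsIdeal {R : Type*} [CommRing R] {t : ℕ} {N M : Type*} [Fintype N]
    [DecidableEq N] (ht : Fintype.card N = t) (A : Matrix N M R) (c : N → M) :
    (A.submatrix id c).det ∈ minorsIdeal t A := by
  refine Ideal.subset_span ⟨(Fintype.equivFinOfCardEq ht).symm,
    c ∘ (Fintype.equivFinOfCardEq ht).symm, ?_⟩
  rw [← Matrix.det_submatrix_equiv_self (Fintype.equivFinOfCardEq ht).symm,
    Matrix.submatrix_submatrix]
  rfl

open Matrix in
lemma exists_det_eq_zero_mul_eq {K : Type*} [Field K] {m n : ℕ} (A : Matrix (Fin n) (Fin m) K)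
    (hA : ∀ c : Fin n → Fin m, (A.submatrix id c).det = 0) :
    ∃ B : Matrix (Fin n) (Fin n) K, B.det = 0 ∧ B * A = A := by
  obtain ⟨v, hv, hvA⟩ : ∃ v : Fin n → K, v ≠ 0 ∧ v ᵥ* A = 0 := by
    by_contra! h
    have hli : LinearIndependent K A.row := by
      rw [← Matrix.vecMul_injective_iff]
      refine (injective_iff_map_eq_zero A.vecMulLinear).2 fun v hv => ?_
      by_contra hne
      exact h v hne hv
    have hrank : Module.finrank K (Submodule.span K (Set.range A.col)) = n := by
      rw [← rank_eq_finrank_span_cols, hli.rank_matrix, Fintype.card_fin]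
    have hcol := Submodule.exists_fun_fin_finrank_span_eq K (Set.range A.col)
    rw [hrank] at hcol
    obtain ⟨f, hf, -, hfli⟩ := hcol
    choose c hc using hf
    have hfc : (A.submatrix id c).col = f := funext hc
    rw [← hfc, linearIndependent_cols_iff_isUnit, isUnit_iff_isUnit_det, hA c] at hfli
    exact not_isUnit_zero hfli
  obtain ⟨i, hi⟩ := Function.ne_iff.1 hv
  have hi : v i ≠ 0 := hi
  have hvw : v ⬝ᵥ Pi.single i (v i)⁻¹ = 1 := by
    rw [dotProduct_single, mul_inv_cancel₀ hi]
  refine ⟨1 - vecMulVec (Pi.single i (v i)⁻¹) v, ?_, ?_⟩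
  · refine exists_vecMul_eq_zero_iff.1 ⟨v, hv, ?_⟩
    rw [vecMul_sub, vecMul_one, vecMul_vecMulVec, hvw, one_smul, sub_self]
  · rw [Matrix.sub_mul, Matrix.one_mul, vecMulVec_mul, hvA]
    ext
    simp [vecMulVec_apply]

lemma minorsIdeal_symPowMatrix_eq_bot {V : Type*} [CommRing V] [IsDomain V] {m n d : ℕ}
    (hn : 0 < n) (hd : 1 ≤ d) (A : Matrix (Fin n) (Fin m) V)
    (hA : ∀ c : Fin n → Fin m, (A.submatrix id c).det = 0) :
    minorsIdeal ((n + d - 1).choose d) (symPowMatrix d A) = ⊥ := by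
  let f := algebraMap V (FractionRing V)
  have hf : Function.Injective f := IsFractionRing.injective V (FractionRing V)
  rw [← Ideal.map_eq_bot_iff_of_injective hf, minorsIdeal_map, ← symPowMatrix_map]
  obtain ⟨B, hB, hBA⟩ := exists_det_eq_zero_mul_eq (A.map f) fun c => by
    have := congrArg f (hA c)
    rwa [RingHom.map_det, map_zero] at this
  rw [← hBA, symPowMatrix_mul, eq_bot_iff]
  refine (minorsIdeal_mul_le (by simp [Sym.card_sym_eq_choose]) _ _).trans ?_
  have hs : (n + d - 1).choose (d - 1) ≠ 0 := (Nat.choose_pos (by omega)).ne'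
  rw [det_symPowMatrix hd, hB, zero_pow hs, Ideal.span_singleton_eq_bot.2 rfl]

lemma minorsIdeal_le_span {R : Type*} [CommRing R] {m n : ℕ} (A : Matrix (Fin n) (Fin m) R)
    (x : R) (hx : ∀ c : Fin n → Fin m, x ∣ (A.submatrix id c).det) :
    minorsIdeal n A ≤ Ideal.span {x} := by
  rw [minorsIdeal, Ideal.span_le]
  rintro _ ⟨r, c, rfl⟩
  have := det_submatrix_mul (Equiv.refl (Fin n)) 1 A r c
  rw [Matrix.one_mul] at this
  rw [this]
  exact Ideal.mul_mem_left _ _ (Ideal.mem_span_singleton.2 (hx c))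

open Matrix in
lemma exists_eq_submatrix_mul {V : Type*} [CommRing V] [IsDomain V] {m n : ℕ}
    (A : Matrix (Fin n) (Fin m) V) (c₀ : Fin n → Fin m) (h0 : (A.submatrix id c₀).det ≠ 0)
    (hc : ∀ c : Fin n → Fin m, (A.submatrix id c₀).det ∣ (A.submatrix id c).det) :
    ∃ C : Matrix (Fin n) (Fin m) V, A = A.submatrix id c₀ * C := by
  set B := A.submatrix id c₀ with hB
  have hdvd (i : Fin n) (j : Fin m) : B.det ∣ (B.adjugate * A) i j := by
    have : (B.adjugate * A) i j = (A.submatrix id (Function.update c₀ i j)).det := by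
      have h1 : (B.adjugate * A) i j = (B.adjugate *ᵥ (fun k => A k j)) i := rfl
      rw [h1, ← cramer_eq_adjugate_mulVec, cramer_apply]
      congr 1
      ext k l
      by_cases hl : l = i
      · subst hl; simp
      · simp [hl, B]
    rw [this]
    exact hc _
  choose C hC using hdvd
  refine ⟨C, ?_⟩
  have h1 : B.adjugate * A = B.det • (Matrix.of C) := by
    ext i j
    simp [hC]
  have h2 := congrArg (B * ·) h1
  simp only [← Matrix.mul_assoc, mul_adjugate, Matrix.mul_smul, Matrix.smul_mul, Matrix.one_mul]
    at h2
  ext i j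
  have := congrFun₂ h2 i j
  simp only [Matrix.smul_apply, smul_eq_mul] at this
  exact mul_left_cancel₀ h0 this

lemma ValuationRing.exists_forall_dvd {V ι : Type*} [CommRing V] [IsDomain V] [ValuationRing V]
    [Finite ι] [Nonempty ι] (f : ι → V) : ∃ i, ∀ j, f i ∣ f j := by
  obtain ⟨i, hi⟩ := Directed.finite_le (r := fun x y : V => y ∣ x) (f := f) (fun i j => by
    rcases ValuationRing.dvd_total (f i) (f j) with h | h
    · exact ⟨i, dvd_rfl, h⟩
    · exact ⟨j, h, dvd_rfl⟩) id
  exact ⟨i, hi⟩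

theorem minorsIdeal_symPowMatrix_of_valuationRing {V : Type*} [CommRing V] [IsDomain V]
    [ValuationRing V] {m n d : ℕ} (hd : 1 ≤ d) (A : Matrix (Fin n) (Fin m) V) :
    minorsIdeal ((n + d - 1).choose d) (symPowMatrix d A) =
      minorsIdeal n A ^ ((n + d - 1).choose (d - 1)) := by
  have hcard : Fintype.card (Sym (Fin n) d) = (n + d - 1).choose d := by
    simp [Sym.card_sym_eq_choose]
  by_cases hA : ∀ c : Fin n → Fin m, (A.submatrix id c).det = 0
  · have hn : 0 < n := by
      rcases Nat.eq_zero_or_pos n with rfl | hn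
      · simpa using hA Fin.elim0
      · exact hn
    have hs : (n + d - 1).choose (d - 1) ≠ 0 := (Nat.choose_pos (by omega)).ne'
    have h0 : minorsIdeal n A = ⊥ := by
      rw [eq_bot_iff, ← Ideal.span_singleton_eq_bot.2 rfl]
      exact minorsIdeal_le_span A 0 fun c => by rw [hA c]
    rw [minorsIdeal_symPowMatrix_eq_bot hn hd A hA, h0, Ideal.bot_pow hs]
  · push Not at hA
    obtain ⟨c₁, hc₁⟩ := hA
    have : Nonempty (Fin n → Fin m) := ⟨c₁⟩
    obtain ⟨c₀, hc₀⟩ := ValuationRing.exists_forall_dvd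
      fun c : Fin n → Fin m => (A.submatrix id c).det
    have h0 : (A.submatrix id c₀).det ≠ 0 := fun h => hc₁ (zero_dvd_iff.1 (h ▸ hc₀ c₁))
    have hI : minorsIdeal n A = Ideal.span {(A.submatrix id c₀).det} :=
      le_antisymm (minorsIdeal_le_span A _ hc₀) ((Ideal.span_singleton_le_iff_mem _).2
        (det_submatrix_mem_minorsIdeal (Fintype.card_fin n) A c₀))
    obtain ⟨C, hC⟩ := exists_eq_submatrix_mul A c₀ h0 hc₀
    rw [hI, Ideal.span_singleton_pow, ← det_symPowMatrix hd]
    refine le_antisymm ?_ ((Ideal.span_singleton_le_iff_mem _).2 ?_)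
    · conv_lhs => rw [hC, symPowMatrix_mul]
      exact minorsIdeal_mul_le hcard _ _
    · rw [symPowMatrix_submatrix]
      exact det_submatrix_mem_minorsIdeal hcard _ _

lemma Ideal.sup_pow_succ_le {R : Type*} [CommRing R] (I J : Ideal R) (N : ℕ) :
    (I ⊔ J) ^ (N + 1) ≤ I ^ (N + 1) ⊔ (I ⊔ J) ^ N * J := by
  induction N with
  | zero => simp
  | succ N ih =>
    calc (I ⊔ J) ^ (N + 1 + 1) = (I ⊔ J) * (I ⊔ J) ^ (N + 1) := pow_succ' _ _
      _ ≤ (I ⊔ J) * (I ^ (N + 1) ⊔ (I ⊔ J) ^ N * J) := Ideal.mul_mono_right ih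
      _ = (I ^ (N + 1 + 1) ⊔ J * I ^ (N + 1)) ⊔ (I ⊔ J) ^ (N + 1) * J := by
        rw [Ideal.mul_sup, Ideal.sup_mul, ← mul_assoc, ← pow_succ', ← pow_succ']
      _ ≤ I ^ (N + 1 + 1) ⊔ (I ⊔ J) ^ (N + 1) * J := by
        refine sup_le (sup_le le_sup_left ?_) le_sup_right
        rw [mul_comm]
        exact (Ideal.mul_mono_left (Ideal.pow_right_mono le_sup_left _)).trans le_sup_right

lemma Ideal.mem_intClosure_of_pow_mem {R : Type*} [CommRing R] {I : Ideal R} {x : R} {N : ℕ}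
    (h : x ^ (N + 1) ∈ I * (I ⊔ Ideal.span {x}) ^ N) : x ∈ I.intClosure := by
  have key : ∀ N : ℕ, ∀ y ∈ I * (I ⊔ Ideal.span {x}) ^ N, ∃ a : ℕ → R,
      (∀ i ∈ Finset.Icc 1 (N + 1), a i ∈ I ^ i) ∧
        y = ∑ i ∈ Finset.Icc 1 (N + 1), a i * x ^ (N + 1 - i) := by
    intro N
    induction N with
    | zero =>
      intro y hy
      refine ⟨fun _ => y, ?_, by simp⟩
      simpa using hy
    | succ N ih =>
      intro y hy
      have hy := Ideal.mul_mono_right (Ideal.sup_pow_succ_le I (Ideal.span {x}) N) hy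
      rw [Ideal.mul_sup, ← pow_succ', ← mul_assoc, Submodule.mem_sup] at hy
      obtain ⟨u, hu, w, hw, rfl⟩ := hy
      obtain ⟨z, hz, rfl⟩ := Ideal.mem_mul_span_singleton.1 hw
      obtain ⟨b, hb, rfl⟩ := ih z hz
      refine ⟨fun i => if i = N + 1 + 1 then u else b i, fun i hi => ?_, ?_⟩
      · rw [Finset.mem_Icc] at hi
        by_cases h : i = N + 1 + 1
        · simpa [h] using hu
        · simpa [h] using hb i (Finset.mem_Icc.2 ⟨hi.1, by omega⟩)
      · rw [Finset.sum_Icc_succ_top (b := N + 1) (by omega), add_comm, Finset.sum_mul]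
        congr 1
        · refine Finset.sum_congr rfl fun i hi => ?_
          rw [Finset.mem_Icc] at hi
          simp only
          rw [if_neg (by omega), show N + 1 + 1 - i = N + 1 - i + 1 by omega, pow_succ, mul_assoc]
        · simp
  obtain ⟨a, ha, hax⟩ := key N _ h
  refine ⟨N + 1, N.succ_pos, fun i => -a i, fun i hi => neg_mem (ha i hi), ?_⟩
  simp only [neg_mul, Finset.sum_neg_distrib]
  rw [hax, add_neg_cancel]

/-- The subring `R[I / x]` of `R[1 / x]`. -/
def affineBlowup {R : Type*} [CommRing R] (I : Ideal R) (x : R) :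
    Subring (Localization.Away x) where
  carrier := {y | ∃ N : ℕ, ∃ g ∈ (I ⊔ Ideal.span {x}) ^ N,
    algebraMap R (Localization.Away x) (x ^ N) * y = algebraMap R (Localization.Away x) g}
  mul_mem' := by
    rintro y z ⟨N, g, hg, hy⟩ ⟨M, h, hh, hz⟩
    refine ⟨N + M, g * h, pow_add (I ⊔ Ideal.span {x}) N M ▸ Ideal.mul_mem_mul hg hh, ?_⟩
    rw [map_mul, ← hy, ← hz, pow_add, map_mul]
    ring
  one_mem' := ⟨0, 1, by simp, by simp⟩
  add_mem' := by
    rintro y z ⟨N, g, hg, hy⟩ ⟨M, h, hh, hz⟩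
    have hx (k : ℕ) : x ^ k ∈ (I ⊔ Ideal.span {x}) ^ k :=
      Ideal.pow_mem_pow (Ideal.mem_sup_right (Ideal.mem_span_singleton_self x)) k
    refine ⟨N + M, g * x ^ M + x ^ N * h, ?_, ?_⟩
    · rw [pow_add]
      exact add_mem (Ideal.mul_mem_mul hg (hx M)) (Ideal.mul_mem_mul (hx N) hh)
    · rw [map_add, map_mul, map_mul, ← hy, ← hz, pow_add, map_mul]
      ring
  zero_mem' := ⟨0, 0, zero_mem _, by simp⟩
  neg_mem' := by
    rintro y ⟨N, g, hg, hy⟩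
    exact ⟨N, -g, neg_mem hg, by rw [mul_neg, hy, map_neg]⟩

/-- The ideal of `R[I / x]` generated by `I / x`. -/
def affineBlowupIdeal {R : Type*} [CommRing R] (I : Ideal R) (x : R) :
    Ideal (affineBlowup I x) where
  carrier := {y | ∃ N : ℕ, ∃ g ∈ I * (I ⊔ Ideal.span {x}) ^ N,
    algebraMap R (Localization.Away x) (x ^ (N + 1)) * y = algebraMap R (Localization.Away x) g}
  add_mem' := by
    rintro y z ⟨N, g, hg, hy⟩ ⟨M, h, hh, hz⟩
    have hx (k : ℕ) : x ^ k ∈ (I ⊔ Ideal.span {x}) ^ k :=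
      Ideal.pow_mem_pow (Ideal.mem_sup_right (Ideal.mem_span_singleton_self x)) k
    refine ⟨N + M + 1, g * x ^ (M + 1) + h * x ^ (N + 1), ?_, ?_⟩
    · refine add_mem ?_ ?_
      · rw [add_assoc, pow_add, ← mul_assoc]
        exact Ideal.mul_mem_mul hg (hx _)
      · rw [show N + M + 1 = M + (N + 1) by ring, pow_add, ← mul_assoc]
        exact Ideal.mul_mem_mul hh (hx _)
    · rw [map_add, map_mul, map_mul, ← hy, ← hz, Subring.coe_add]
      simp only [map_pow]
      ring
  zero_mem' := ⟨0, 0, zero_mem _, by simp⟩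
  smul_mem' := by
    rintro y z ⟨N, g, hg, hz⟩
    obtain ⟨M, h, hh, hy⟩ := y.2
    refine ⟨N + M, g * h, ?_, ?_⟩
    · rw [pow_add, ← mul_assoc]
      exact Ideal.mul_mem_mul hg hh
    · rw [map_mul, ← hy, ← hz, smul_eq_mul, Subring.coe_mul]
      simp only [map_pow]
      ring

lemma algebraMap_mem_affineBlowup {R : Type*} [CommRing R] (I : Ideal R) (x y : R) :
    algebraMap R (Localization.Away x) y ∈ affineBlowup I x :=
  ⟨0, y, by simp, by simp⟩

lemma affineBlowupIdeal_ne_top {R : Type*} [CommRing R] {I : Ideal R} {x : R}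
    (hx : x ∉ I.intClosure) : affineBlowupIdeal I x ≠ ⊤ := by
  intro h
  obtain ⟨N, g, hg, h1⟩ := (Ideal.eq_top_iff_one _).1 h
  rw [Subring.coe_one, mul_one, IsLocalization.eq_iff_exists (Submonoid.powers x)] at h1
  obtain ⟨⟨_, k, rfl⟩, hk⟩ := h1
  refine hx (Ideal.mem_intClosure_of_pow_mem (N := N + k) ?_)
  have : x ^ (N + k + 1) = g * x ^ k := by
    rw [mul_comm g]
    refine Eq.trans ?_ hk
    ring
  rw [this, pow_add, ← mul_assoc]
  exact Ideal.mul_mem_mul hg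
    (Ideal.pow_mem_pow (Ideal.mem_sup_right (Ideal.mem_span_singleton_self x)) k)

lemma Ideal.notMem_map_of_forall_exists_mul {R V : Type*} [CommRing R] [CommRing V] [IsDomain V]
    [IsLocalRing V] {I : Ideal R} {x : R} (f : R →+* V) (hx : f x ≠ 0)
    (h : ∀ y ∈ I, ∃ c ∈ IsLocalRing.maximalIdeal V, f x * c = f y) : f x ∉ I.map f := by
  intro hmem
  have hle : I.map f ≤ Ideal.span {f x} * IsLocalRing.maximalIdeal V :=
    Ideal.map_le_iff_le_comap.2 fun y hy => Ideal.mem_span_singleton_mul.2 (h y hy)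
  obtain ⟨c, hc, hcx⟩ := Ideal.mem_span_singleton_mul.1 (hle hmem)
  have hc1 : c = 1 := mul_left_cancel₀ hx (hcx.trans (mul_one _).symm)
  exact (Ideal.ne_top_iff_one _).1 (IsLocalRing.maximalIdeal.isMaximal V).ne_top (hc1 ▸ hc)

universe u in
/-- The hard half of the valuative criterion for integral dependence on an ideal. -/
theorem Ideal.exists_valuationSubring_of_notMem_intClosure {R : Type u} [CommRing R] {I : Ideal R}
    {x : R} (hx : x ∉ I.intClosure) :
    ∃ (K : Type u) (_ : Field K) (V : ValuationSubring K) (f : R →+* V), f x ∉ I.map f := by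
  let L := Localization.Away x
  obtain ⟨𝔪, hmax, hm⟩ := Ideal.exists_le_maximal _ (affineBlowupIdeal_ne_top hx)
  have hmp : 𝔪.IsPrime := hmax.isPrime
  obtain ⟨𝔭, hpmin, hpm⟩ := Ideal.exists_minimalPrimes_le (bot_le (a := 𝔪))
  obtain ⟨𝔮, hq, hqp⟩ := Ideal.exists_comap_eq_of_mem_minimalPrimes_of_injective
    (f := (affineBlowup I x).subtype) Subtype.val_injective 𝔭 hpmin
  let K := FractionRing (L ⧸ 𝔮)
  let π : L →+* K := (algebraMap (L ⧸ 𝔮) K).comp (Ideal.Quotient.mk 𝔮)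
  have hπ (y : L) : π y = 0 ↔ y ∈ 𝔮 := by
    rw [← Ideal.Quotient.eq_zero_iff_mem]
    exact map_eq_zero_iff _ (IsFractionRing.injective (L ⧸ 𝔮) K)
  let g : Localization.AtPrime 𝔪 →+* K :=
    IsLocalization.lift (M := 𝔪.primeCompl) (g := π.comp (affineBlowup I x).subtype) fun y => by
      refine isUnit_iff_ne_zero.2 fun h0 => y.2 (hpm ?_)
      rw [← hqp]
      exact (hπ _).1 h0
  obtain ⟨V, hV, hloc⟩ := IsLocalRing.exists_factor_valuationRing g
  let ρ : affineBlowup I x →+* V :=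
    RingHom.comp (g.codRestrict V.toSubring hV) (algebraMap _ (Localization.AtPrime 𝔪))
  have hρ (a : affineBlowup I x) : (ρ a : K) = π a :=
    IsLocalization.lift_eq (M := 𝔪.primeCompl) _ a
  have hρm (a : affineBlowup I x) (ha : a ∈ 𝔪) : ρ a ∈ IsLocalRing.maximalIdeal V := by
    intro hu
    have : IsUnit (algebraMap _ (Localization.AtPrime 𝔪) a) := hloc.map_nonunit _ hu
    exact (IsLocalization.AtPrime.isUnit_to_map_iff _ 𝔪 a).1 this ha
  let ι : R →+* affineBlowup I x :=
    (algebraMap R L).codRestrict _ (algebraMap_mem_affineBlowup I x)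
  have hxu : IsUnit (algebraMap R L x) := IsLocalization.Away.algebraMap_isUnit x
  refine ⟨K, inferInstance, V, ρ.comp ι,
    Ideal.notMem_map_of_forall_exists_mul _ (fun h0 => ?_) fun y hy => ?_⟩
  · have h1 : π (algebraMap R L x) = 0 := (hρ (ι x)).symm.trans (congrArg Subtype.val h0)
    exact (hxu.map π).ne_zero h1
  · have hz : algebraMap R L x * (hxu.unit⁻¹ * algebraMap R L y) = algebraMap R L y := by
      rw [← mul_assoc, IsUnit.mul_val_inv, one_mul]
    let z : affineBlowup I x := ⟨hxu.unit⁻¹ * algebraMap R L y, 1, y, by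
      rw [pow_one]
      exact Ideal.mem_sup_left hy, by rw [pow_one]; exact hz⟩
    have hzJ : z ∈ affineBlowupIdeal I x :=
      ⟨0, y, by simpa using hy, by rw [zero_add, pow_one]; exact hz⟩
    have hyz : ι x * z = ι y := Subtype.ext hz
    exact ⟨ρ z, hρm z (hm hzJ), (map_mul ρ (ι x) z).symm.trans (congrArg ρ hyz)⟩

theorem Ideal.map_mem_of_mem_intClosure {R V : Type*} [CommRing R] [CommRing V] [IsDomain V]
    [ValuationRing V] {I : Ideal R} {x : R} (hx : x ∈ I.intClosure) (f : R →+* V) :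
    f x ∈ I.map f := by
  by_contra hmem
  obtain ⟨k, hk, a, ha, hxa⟩ := hx
  have hle : I.map f ≤ Ideal.span {f x} * IsLocalRing.maximalIdeal V := by
    intro y hy
    rcases ValuationRing.dvd_total y (f x) with h | ⟨c, rfl⟩
    · exact absurd (Ideal.mem_of_dvd _ h hy) hmem
    · refine Ideal.mul_mem_mul (Ideal.mem_span_singleton_self _) fun hc => hmem ?_
      exact (Ideal.mul_unit_mem_iff_mem _ hc).1 hy
  have hx0 : f x ≠ 0 := fun h => hmem (h ▸ zero_mem _)
  have hterm (i : ℕ) (hi : i ∈ Finset.Icc 1 k) :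
      f (a i * x ^ (k - i)) ∈ Ideal.span {f x ^ k} * IsLocalRing.maximalIdeal V := by
    have hi' := Finset.mem_Icc.1 hi
    have h1 : f (a i) ∈ Ideal.span {f x ^ i} * IsLocalRing.maximalIdeal V := by
      have h2 := Ideal.pow_right_mono hle i
        (Ideal.map_pow f I i ▸ Ideal.mem_map_of_mem f (ha i hi))
      rw [mul_pow, Ideal.span_singleton_pow] at h2
      exact Ideal.mul_mono_right (Ideal.pow_le_self (by omega)) h2
    obtain ⟨c, hc, hca⟩ := Ideal.mem_span_singleton_mul.1 h1
    refine Ideal.mem_span_singleton_mul.2 ⟨c, hc, ?_⟩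
    rw [map_mul, map_pow, ← hca, mul_right_comm, ← pow_add, Nat.add_sub_cancel' hi'.2]
  have hsum := Ideal.sum_mem _ hterm
  obtain ⟨c, hc, hcx⟩ := Ideal.mem_span_singleton_mul.1 hsum
  have h0 := congrArg f hxa
  rw [map_add, map_sum, ← hcx, map_pow, map_zero] at h0
  have h1 : f x ^ k * (1 + c) = 0 := by rw [mul_add, mul_one, h0]
  have h2 : 1 + c = 0 := (mul_eq_zero.1 h1).resolve_left (pow_ne_zero _ hx0)
  refine (Ideal.ne_top_iff_one _).1 (IsLocalRing.maximalIdeal.isMaximal V).ne_top ?_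
  rw [eq_neg_of_add_eq_zero_left h2]
  exact neg_mem hc

universe u in
theorem Ideal.intClosure_subset_of_map_le {R : Type u} [CommRing R] {I J : Ideal R}
    (h : ∀ (V : Type u) [CommRing V] [IsDomain V] [ValuationRing V] (f : R →+* V),
      I.map f ≤ J.map f) : I.intClosure ⊆ J.intClosure := by
  intro x hx
  by_contra hxJ
  obtain ⟨K, _, V, f, hf⟩ := Ideal.exists_valuationSubring_of_notMem_intClosure hxJ
  exact hf (h V f (Ideal.map_mem_of_mem_intClosure hx f))

/-- For a commutative ring `R`, a linear map `φ : R^m → R^n` and `d ≥ 1`, the ideals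
`I(S^d(φ))` and `I(φ)^s`, `s = (n + d - 1).choose (d - 1)`, have the same integral closure. -/
theorem intClosure_maximalMinors_symPow {R : Type*} [CommRing R] {m n : ℕ}
    (φ : Matrix (Fin n) (Fin m) R) (d : ℕ) (hd : 1 ≤ d) :
    (minorsIdeal ((n + d - 1).choose d) (symPowMatrix d φ)).intClosure =
      (minorsIdeal n φ ^ ((n + d - 1).choose (d - 1))).intClosure := by
  have key (V : Type _) [CommRing V] [IsDomain V] [ValuationRing V] (f : R →+* V) :
      (minorsIdeal ((n + d - 1).choose d) (symPowMatrix d φ)).map f =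
        (minorsIdeal n φ ^ ((n + d - 1).choose (d - 1))).map f := by
    rw [Ideal.map_pow, minorsIdeal_map, minorsIdeal_map, ← symPowMatrix_map,
      minorsIdeal_symPowMatrix_of_valuationRing hd]
  exact Set.Subset.antisymm (Ideal.intClosure_subset_of_map_le fun V _ _ _ f => (key V f).le)
    (Ideal.intClosure_subset_of_map_le fun V _ _ _ f => (key V f).ge)
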